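/- arXiv:1407.2746 — 5 statements merged into one kernel-verified Lean document; each statement's English description precedes it below -/
import Mathlib

section
/- For every real y with 0 ≤ y and (1-q)·y < 1, the series identity ∑_{k=0}^∞ [k]_q·P_k(q;y)/[k]_q! = A(1)·y·e_q^y + e_q^{qy}·D_qA(1) holds. -/
open Filter

/-- The `q`-integer `[n]_q = (1 - q^n)/(1 - q)`. -/
noncomputable def qInt (q : ℝ) (n : ℕ) : ℝ := (1 - q ^ n) / (1 - q)

/-- The `q`-factorial `[n]_q! = [1]_q [2]_q ⋯ [n]_q`, with `[0]_q! = 1`. -/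
noncomputable def qFact (q : ℝ) (n : ℕ) : ℝ := ∏ i ∈ Finset.range n, qInt q (i + 1)

/-- The `q`-exponential `e_q^x = ∑ x^n/[n]_q!`. -/
noncomputable def qExp (q x : ℝ) : ℝ := ∑' n : ℕ, x ^ n / qFact q n

/-- The `q`-exponential `E_q^x = ∑ q^{n(n-1)/2} x^n/[n]_q!`. -/
noncomputable def qExpE (q x : ℝ) : ℝ := ∑' n : ℕ, q ^ (n * (n - 1) / 2) * x ^ n / qFact q n

/-- The power series `A(u) = ∑ c_k u^k`. -/
noncomputable def APow (c : ℕ → ℝ) (u : ℝ) : ℝ := ∑' k : ℕ, c k * u ^ k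

/-- The `q`-Appell polynomial `P_k(q;y) = [k]_q! ∑_{j=0}^k c_j y^{k-j}/[k-j]_q!`. -/
noncomputable def qAppell (c : ℕ → ℝ) (q y : ℝ) (k : ℕ) : ℝ :=
  qFact q k * ∑ j ∈ Finset.range (k + 1), c j * y ^ (k - j) / qFact q (k - j)

/-- `D_q A(1) = (A(1) - A(q))/(1-q)`. -/
noncomputable def DqA1 (c : ℕ → ℝ) (q : ℝ) : ℝ := (APow c 1 - APow c q) / (1 - q)

/-- `D_q A(q) = (A(q) - A(q²))/((1-q) q)`. -/
noncomputable def DqAq (c : ℕ → ℝ) (q : ℝ) : ℝ := (APow c q - APow c (q ^ 2)) / ((1 - q) * q)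

/-- `D_q² A(1) = (D_q A(1) - D_q A(q))/(1-q)`. -/
noncomputable def Dq2A1 (c : ℕ → ℝ) (q : ℝ) : ℝ := (DqA1 c q - DqAq c q) / (1 - q)

/-- The Stancu-type `q`-Favard–Szász operator `T_{n,t}^{α,β}(f;q;x)`. -/
noncomputable def Tq (c : ℕ → ℝ) (q : ℝ) (n : ℕ) (t α β : ℝ) (f : ℝ → ℝ) (x : ℝ) : ℝ :=
  qExpE q (-(qInt q n * t)) / APow c 1 *
    ∑' k : ℕ, qAppell c q (qInt q n * t) k / qFact q k *
      f (x + (qInt q k + α) / (qInt q n + β))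

/-- Statistical convergence of a real sequence to `l`. -/
def StatLim (x : ℕ → ℝ) (l : ℝ) : Prop :=
  ∀ ε > 0, Tendsto
    (fun n : ℕ => (((Finset.Icc 1 n).filter fun k => ε ≤ |x k - l|).card : ℝ) / n)
    atTop (nhds 0)

/-- Modulus of continuity of `f` on `[0,∞)`. -/
noncomputable def modCont (f : ℝ → ℝ) (δ : ℝ) : ℝ :=
  sSup {r : ℝ | ∃ u v : ℝ, 0 ≤ u ∧ 0 ≤ v ∧ |u - v| ≤ δ ∧ r = |f u - f v|}

/-- Second-order modulus of smoothness of `f` on `[0,∞)`. -/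
noncomputable def mod2 (f : ℝ → ℝ) (δ : ℝ) : ℝ :=
  sSup {r : ℝ | ∃ h x : ℝ, 0 < h ∧ h ≤ δ ∧ 0 ≤ x ∧
    r = |f (x + 2 * h) - 2 * f (x + h) + f x|}

lemma qInt_succ_pos (q : ℝ) (hq0 : 0 < q) (hq1 : q < 1) (n : ℕ) : 0 < qInt q (n + 1) := by
  unfold qInt
  have := pow_lt_one₀ hq0.le hq1 (Nat.succ_ne_zero n)
  exact div_pos (by simpa using this) (by linarith)

lemma qFact_pos' (q : ℝ) (hq0 : 0 < q) (hq1 : q < 1) (n : ℕ) : 0 < qFact q n :=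
  Finset.prod_pos fun i _ => qInt_succ_pos q hq0 hq1 i

lemma qFact_succ' (q : ℝ) (n : ℕ) : qFact q (n + 1) = qFact q n * qInt q (n + 1) := by
  unfold qFact
  rw [Finset.prod_range_succ]

lemma qExp_summable (q : ℝ) (hq0 : 0 < q) (hq1 : q < 1) (y : ℝ) (hy0 : 0 ≤ y)
    (hy1 : (1 - q) * y < 1) : Summable fun n : ℕ => y ^ n / qFact q n := by
  obtain ⟨r, hr, hr1⟩ := exists_between hy1
  have h1 : Tendsto (fun n : ℕ => y / qInt q (n + 1)) atTop (nhds ((1 - q) * y)) := by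
    have h0 : Tendsto (fun n : ℕ => q ^ (n + 1)) atTop (nhds 0) :=
      (tendsto_add_atTop_iff_nat 1).2 (tendsto_pow_atTop_nhds_zero_of_lt_one hq0.le hq1)
    have hne : (1 - q) ≠ 0 := by linarith
    have h2 := (tendsto_const_nhds (x := y)).div
      ((h0.const_sub 1).div_const (1 - q)) (by simpa using hne)
    have e : y / ((1 - 0) / (1 - q)) = (1 - q) * y := by
      field_simp
      ring
    rw [e] at h2
    exact h2
  refine summable_of_ratio_norm_eventually_le hr1 ?_
  filter_upwards [h1.eventually_lt_const hr] with n hn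
  have p1 := qInt_succ_pos q hq0 hq1 n
  have p2 := qFact_pos' q hq0 hq1 n
  have e : y ^ (n + 1) / qFact q (n + 1) = (y / qInt q (n + 1)) * (y ^ n / qFact q n) := by
    rw [qFact_succ', pow_succ]
    field_simp
  have hn0 : 0 ≤ y ^ n / qFact q n := by positivity
  have hn1 : 0 ≤ y / qInt q (n + 1) := by positivity
  rw [e, Real.norm_of_nonneg (mul_nonneg hn1 hn0), Real.norm_of_nonneg hn0]
  exact mul_le_mul_of_nonneg_right hn.le hn0

lemma qExp_mul (q : ℝ) (hq0 : 0 < q) (hq1 : q < 1) (y : ℝ) (hy0 : 0 ≤ y)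
    (hy1 : (1 - q) * y < 1) : qExp q y - qExp q (q * y) = (1 - q) * y * qExp q y := by
  have hne : (1 - q) ≠ 0 := by linarith
  have s1 := qExp_summable q hq0 hq1 y hy0 hy1
  have s2 := qExp_summable q hq0 hq1 (q * y) (by positivity) (by nlinarith)
  unfold qExp
  rw [← s1.tsum_sub s2, (s1.sub s2).tsum_eq_zero_add, ← tsum_mul_left]
  simp only [pow_zero, sub_self, zero_add]
  congr 1
  ext n
  have p1 := qInt_succ_pos q hq0 hq1 n
  have p2 := qFact_pos' q hq0 hq1 n
  have e : 1 - q ^ (n + 1) = (1 - q) * qInt q (n + 1) := by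
    unfold qInt
    field_simp
  rw [qFact_succ', mul_pow, ← sub_div, ← one_sub_mul, e]
  field_simp
  ring

/-- `∑_{k=0}^∞ [k]_q P_k(q;y)/[k]_q! = A(1) y e_q^y + e_q^{qy} D_q A(1)`. -/
theorem stmt_1 (q : ℝ) (hq0 : 0 < q) (hq1 : q < 1)
    (c : ℕ → ℝ) (hc : ∀ k, 0 ≤ c k)
    (hrad : ∃ R : ℝ, 1 < R ∧ Summable fun k => c k * R ^ k) (hA1 : 0 < APow c 1)
    (y : ℝ) (hy0 : 0 ≤ y) (hy1 : (1 - q) * y < 1) :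
    ∑' k : ℕ, qInt q k * qAppell c q y k / qFact q k =
      APow c 1 * y * qExp q y + qExp q (q * y) * DqA1 c q := by
  obtain ⟨R, hR, hs⟩ := hrad
  have hne : (1 - q) ≠ 0 := by linarith
  have hA : ∀ u : ℝ, 0 ≤ u → u ≤ 1 → Summable fun k => c k * u ^ k := by
    intro u h0 h1
    refine Summable.of_nonneg_of_le (fun k => mul_nonneg (hc k) (pow_nonneg h0 k)) (fun k => ?_) hs
    exact mul_le_mul_of_nonneg_left (pow_le_pow_left₀ h0 (by linarith) k) (hc k)
  have key : ∀ u : ℝ, 0 ≤ u → u ≤ 1 →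
      HasSum (fun k => u ^ k * ∑ j ∈ Finset.range (k + 1), c j * y ^ (k - j) / qFact q (k - j))
        (APow c u * qExp q (u * y)) := by
    intro u h0 h1
    have s2 := qExp_summable q hq0 hq1 (u * y) (by positivity)
      (lt_of_le_of_lt (mul_le_mul_of_nonneg_left (mul_le_of_le_one_left hy0 h1) (by linarith)) hy1)
    have := hasSum_sum_range_mul_of_summable_norm (hA u h0 h1).norm s2.norm
    refine (congrArg (fun f => HasSum f (APow c u * qExp q (u * y))) (funext fun k => ?_)).mpr this
    rw [Finset.mul_sum]
    refine Finset.sum_congr rfl fun j hj => ?_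
    have hj' : j ≤ k := by simpa [Nat.lt_succ_iff] using hj
    have e : u ^ k = u ^ j * u ^ (k - j) := by rw [← pow_add, Nat.add_sub_cancel' hj']
    rw [e, mul_pow]
    ring
  have k1 := key 1 zero_le_one le_rfl
  have k2 := key q hq0.le hq1.le
  have k3 := (k1.sub k2).div_const (1 - q)
  have hx := qExp_mul q hq0 hq1 y hy0 hy1
  have e : (fun k : ℕ => qInt q k * qAppell c q y k / qFact q k) = fun k =>
      (1 ^ k * ∑ j ∈ Finset.range (k + 1), c j * y ^ (k - j) / qFact q (k - j) -
        q ^ k * ∑ j ∈ Finset.range (k + 1), c j * y ^ (k - j) / qFact q (k - j)) / (1 - q) := by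
    ext k
    have p2 := (qFact_pos' q hq0 hq1 k).ne'
    unfold qAppell qInt
    generalize (∑ j ∈ Finset.range (k + 1), c j * y ^ (k - j) / qFact q (k - j)) = S
    field_simp
    ring
  rw [e, k3.tsum_eq, one_mul]
  unfold DqA1
  field_simp
  linear_combination APow c 1 * hx
end

section
/- Let β ≥ 0 and let (q_n)_{n≥1} be a sequence with 0 < q_n < 1 for all n such that st-lim q_n = 1 and st-lim q_n^n = b for some b < 1. Then st-lim 1/([n]_{q_n} + β) = 0, where [n]_{q_n} = (1-q_n^n)/(1-q_n). -/
open Filter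

/-- if `st-lim qₙ = 1` and `st-lim qₙⁿ = b < 1`, then
    `st-lim 1/([n]_{qₙ} + β) = 0`. -/
theorem stmt_6 (β : ℝ) (hβ : 0 ≤ β) (qs : ℕ → ℝ)
    (hqs : ∀ n, 0 < qs n ∧ qs n < 1)
    (hst1 : StatLim qs 1) (b : ℝ) (hb : b < 1)
    (hst2 : StatLim (fun n => qs n ^ n) b) :
    StatLim (fun n => 1 / (qInt (qs n) n + β)) 0 := by
  intro ε hε
  have hc : 0 < (1 - b) / 2 := by linarith
  have h1 := hst1 (ε * ((1 - b) / 2)) (mul_pos hε hc)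
  have h2 := hst2 ((1 - b) / 2) hc
  have h3 := h1.add h2
  rw [add_zero] at h3
  refine squeeze_zero (fun n => by positivity) (fun n => ?_) h3
  rw [← add_div]
  refine div_le_div_of_nonneg_right ?_ (Nat.cast_nonneg n)
  rw [← Nat.cast_add, Nat.cast_le]
  refine le_trans (Finset.card_le_card ?_) (Finset.card_union_le _ _)
  intro k hk
  simp only [Finset.mem_union, Finset.mem_filter] at hk ⊢
  obtain ⟨hk1, hk2⟩ := hk
  by_contra hcon
  have hA : ¬ (ε * ((1 - b) / 2) ≤ |qs k - 1|) := fun h => hcon (Or.inl ⟨hk1, h⟩)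
  have hB : ¬ ((1 - b) / 2 ≤ |qs k ^ k - b|) := fun h => hcon (Or.inr ⟨hk1, h⟩)
  rw [not_le, abs_lt] at hA hB
  obtain ⟨hq0, hq1⟩ := hqs k
  have hd : 0 < 1 - qs k := by linarith
  have hI : 1 / ε < qInt (qs k) k := by
    unfold qInt
    rw [div_lt_div_iff₀ hε hd]
    nlinarith [mul_lt_mul_of_pos_left (show (1 - b) / 2 < 1 - qs k ^ k by linarith [hB.2]) hε, hA.1]
  have hp : 0 < 1 / ε := by positivity
  have hS : 1 / ε < qInt (qs k) k + β := by linarith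
  have hS0 : 0 < qInt (qs k) k + β := by linarith
  rw [sub_zero, abs_of_pos (by positivity), le_div_iff₀ hS0] at hk2
  rw [div_lt_iff₀ hε] at hS
  linarith
end

section
/- Let α, β ≥ 0, let a > 0, and let (q_n)_{n≥1} be a sequence with 0 < q_n < 1 and (1-q_n^n)·a < 1 for all n, such that st-lim q_n = 1 and st-lim q_n^n = b for some b < 1. Then for every bounded continuous function f : [0,∞) → ℝ, st-lim_n sup_{x∈[0,a], t∈[0,a]} |T_{n,t}^{α,β}(f;q_n;x) − f(x+t)| = 0. -/
open Filter

namespace QAux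

lemma qInt_zero (q : ℝ) : qInt q 0 = 0 := by simp [qInt]

lemma qInt_add {q : ℝ} (h1 : q < 1) (j m : ℕ) :
    qInt q (j + m) = qInt q m + q ^ m * qInt q j := by
  have : 1 - q ≠ 0 := by linarith
  unfold qInt; field_simp; ring

lemma qInt_succ {q : ℝ} (h1 : q < 1) (m : ℕ) : qInt q (m + 1) = 1 + q * qInt q m := by
  have : 1 - q ≠ 0 := by linarith
  unfold qInt; field_simp; ring

lemma qInt_nonneg {q : ℝ} (h0 : 0 < q) (h1 : q < 1) (m : ℕ) : 0 ≤ qInt q m :=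
  div_nonneg (sub_nonneg.2 (pow_le_one₀ h0.le h1.le)) (by linarith)

lemma qInt_succ_pos {q : ℝ} (h0 : 0 < q) (h1 : q < 1) (m : ℕ) : 0 < qInt q (m + 1) := by
  have := qInt_nonneg h0 h1 m
  rw [qInt_succ h1]; positivity

lemma qInt_le {q : ℝ} (h0 : 0 < q) (h1 : q < 1) (m : ℕ) : qInt q m ≤ m := by
  induction m with
  | zero => simp [qInt_zero]
  | succ k ih =>
    have := qInt_nonneg h0 h1 k
    rw [qInt_succ h1]; push_cast; nlinarith

lemma qFact_succ (q : ℝ) (m : ℕ) : qFact q (m + 1) = qFact q m * qInt q (m + 1) :=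
  Finset.prod_range_succ _ _

lemma qFact_zero (q : ℝ) : qFact q 0 = 1 := by simp [qFact]

lemma qFact_pos {q : ℝ} (h0 : 0 < q) (h1 : q < 1) (m : ℕ) : 0 < qFact q m :=
  Finset.prod_pos fun i _ => qInt_succ_pos h0 h1 i

lemma summable_e {q y : ℝ} (h0 : 0 < q) (h1 : q < 1) (hy : 0 ≤ y) (hy1 : (1 - q) * y < 1) :
    Summable fun m => y ^ m / qFact q m := by
  rcases hy.eq_or_lt with rfl | hy
  · refine summable_of_ne_finset_zero (s := {0}) ?_
    intro b hb
    have : b ≠ 0 := by simpa using hb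
    simp [this]
  have hpos : ∀ m, 0 < y ^ m / qFact q m := fun m => div_pos (pow_pos hy m) (qFact_pos h0 h1 m)
  refine summable_of_ratio_test_tendsto_lt_one hy1 (Eventually.of_forall fun m => (hpos m).ne') ?_
  have : ∀ m, ‖y ^ (m + 1) / qFact q (m + 1)‖ / ‖y ^ m / qFact q m‖
      = (1 - q) * y / (1 - q ^ (m + 1)) := by
    intro m
    rw [Real.norm_of_nonneg (hpos _).le, Real.norm_of_nonneg (hpos _).le, qFact_succ]
    have := qFact_pos h0 h1 m
    have h2 : 1 - q ≠ 0 := by linarith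
    have h3 : 1 - q ^ (m + 1) ≠ 0 := by
      have := pow_lt_one₀ h0.le h1 (Nat.succ_ne_zero m)
      have h4 : q ^ (m + 1) < 1 := this
      exact (sub_pos.2 h4).ne'
    unfold qInt
    field_simp
    ring
  simp_rw [this]
  have hq : Tendsto (fun m : ℕ => q ^ (m + 1)) atTop (nhds 0) :=
    (tendsto_pow_atTop_nhds_zero_of_lt_one h0.le h1).comp (tendsto_add_atTop_nat 1)
  have := (tendsto_const_nhds (x := (1 - q) * y)).div (tendsto_const_nhds (x := (1 : ℝ)).sub hq)
    (by norm_num)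
  simpa [Pi.div_def] using this

lemma m1 {q y S : ℝ} (h0 : 0 < q) (h1 : q < 1) (h : HasSum (fun m => y ^ m / qFact q m) S) :
    HasSum (fun m => qInt q m * (y ^ m / qFact q m)) (y * S) := by
  rw [← hasSum_nat_add_iff' 1]
  simp only [Finset.sum_range_one, qInt_zero, zero_mul, sub_zero]
  refine (h.mul_left y).congr_fun ?_
  intro m
  have := qFact_pos h0 h1 m
  have := qInt_succ_pos h0 h1 m
  rw [qFact_succ]; field_simp; ring

lemma m2 {q y S : ℝ} (h0 : 0 < q) (h1 : q < 1) (h : HasSum (fun m => y ^ m / qFact q m) S) :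
    HasSum (fun m => qInt q m ^ 2 * (y ^ m / qFact q m)) (y * (S + q * (y * S))) := by
  rw [← hasSum_nat_add_iff' 1]
  simp only [Finset.sum_range_one, qInt_zero, zero_mul, sub_zero, ne_eq, OfNat.ofNat_ne_zero,
    not_false_eq_true, zero_pow]
  refine ((h.add ((m1 h0 h1 h).mul_left q)).mul_left y).congr_fun ?_
  intro m
  have := qFact_pos h0 h1 m
  have h3 := qInt_succ_pos h0 h1 m
  have : qInt q (m + 1) ^ 2 * (y ^ (m + 1) / qFact q (m + 1))
      = qInt q (m + 1) * (y ^ (m + 1) / qFact q m) := by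
    rw [qFact_succ]; field_simp
  rw [this, qInt_succ h1]; ring

lemma var {q y S : ℝ} (h0 : 0 < q) (h1 : q < 1) (h : HasSum (fun m => y ^ m / qFact q m) S) :
    HasSum (fun m => (qInt q m - y) ^ 2 * (y ^ m / qFact q m)) ((y - (1 - q) * y ^ 2) * S) := by
  have := ((m2 h0 h1 h).sub ((m1 h0 h1 h).mul_left (2 * y))).add (h.mul_left (y ^ 2))
  have e : (y - (1 - q) * y ^ 2) * S = y * (S + q * (y * S)) - 2 * y * (y * S) + y ^ 2 * S := by
    ring
  rw [e]
  refine this.congr_fun fun m => ?_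
  ring

lemma e_step {q y : ℝ} (h0 : 0 < q) (h1 : q < 1) (hs : Summable fun m => y ^ m / qFact q m) :
    qExp q (q * y) = (1 - (1 - q) * y) * qExp q y := by
  have h := hs.hasSum
  have h2 := h.sub ((m1 h0 h1 h).mul_left (1 - q))
  have : qExp q (q * y) = _ := (h2.congr_fun ?_).tsum_eq
  · rw [this, qExp]; ring
  · intro m
    have : (1 - q) ≠ 0 := by linarith
    have h3 : (1 - q) * qInt q m = 1 - q ^ m := by unfold qInt; field_simp
    rw [← mul_assoc, h3, mul_pow]; ring

lemma tri (m : ℕ) : (m + 1) * (m + 1 - 1) / 2 = m * (m - 1) / 2 + m := by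
  have : (m + 1) * (m + 1 - 1) = m * (m - 1) + m * 2 := by
    cases m with
    | zero => rfl
    | succ k => simp; ring
  rw [this, Nat.add_mul_div_right _ _ (by norm_num)]

lemma summable_E {q y : ℝ} (h0 : 0 < q) (h1 : q < 1) (hy : 0 ≤ y)
    (hs : Summable fun m => y ^ m / qFact q m) :
    Summable fun m : ℕ => q ^ (m * (m - 1) / 2) * (-y) ^ m / qFact q m := by
  refine Summable.of_norm_bounded hs ?_
  intro m
  have := qFact_pos h0 h1 m
  rw [norm_div, norm_mul, norm_pow, norm_pow, norm_neg, Real.norm_of_nonneg h0.le,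
    Real.norm_of_nonneg hy, Real.norm_of_nonneg this.le]
  gcongr
  exact mul_le_of_le_one_left (by positivity) (pow_le_one₀ h0.le h1.le)

lemma E_step {q y : ℝ} (h0 : 0 < q) (h1 : q < 1) (hy : 0 ≤ y)
    (hs : Summable fun m => y ^ m / qFact q m)
    (hs' : Summable fun m => (q * y) ^ m / qFact q m) :
    qExpE q (-y) = (1 - (1 - q) * y) * qExpE q (-(q * y)) := by
  have hE := (summable_E h0 h1 hy hs).hasSum
  have hE' := (summable_E h0 h1 (by positivity) hs').hasSum
  have hd := hE.sub hE'
  have hm := hE'.mul_left (-((1 - q) * y))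
  rw [← hasSum_nat_add_iff' 1] at hd
  have : _ = _ := (hd.congr_fun (g := fun m : ℕ => -((1 - q) * y) *
    (q ^ (m * (m - 1) / 2) * (-(q * y)) ^ m / qFact q m)) ?_).unique hm
  · simp only [Finset.sum_range_one] at this
    change qExpE q (-y) - qExpE q (-(q * y)) - _ = -((1 - q) * y) * qExpE q (-(q * y)) at this
    simp at this
    linarith
  · intro m
    have := qFact_pos h0 h1 m
    have h3 := qInt_succ_pos h0 h1 m
    have h4 : (1 - q) * qInt q (m + 1) = 1 - q ^ (m + 1) := by
      have : (1 - q) ≠ 0 := by linarith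
      unfold qInt; field_simp
    rw [tri, qFact_succ, pow_add]
    have e1 : (-(q * y)) = q * (-y) := by ring
    rw [e1, mul_pow, mul_pow]
    field_simp
    linear_combination (-((-y) ^ m * y)) * h4

lemma E_mul_e {q y : ℝ} (h0 : 0 < q) (h1 : q < 1) (hy : 0 ≤ y) (hy1 : (1 - q) * y < 1) :
    qExpE q (-y) * qExp q y = 1 := by
  have hz : ∀ m : ℕ, 0 ≤ q ^ m * y ∧ q ^ m * y ≤ y := fun m =>
    ⟨by positivity, mul_le_of_le_one_left hy (pow_le_one₀ h0.le h1.le)⟩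
  have hsum : ∀ m : ℕ, Summable fun k => (q ^ m * y) ^ k / qFact q k := fun m =>
    summable_e h0 h1 (hz m).1
      (lt_of_le_of_lt (mul_le_mul_of_nonneg_left (hz m).2 (by linarith)) hy1)
  have hconst : ∀ m : ℕ, qExpE q (-(q ^ m * y)) * qExp q (q ^ m * y)
      = qExpE q (-y) * qExp q y := by
    intro m
    induction m with
    | zero => simp
    | succ k ih =>
      have hk := hsum (k + 1)
      rw [pow_succ', mul_assoc] at hk ⊢
      rw [← ih, E_step h0 h1 (hz k).1 (hsum k) hk, e_step h0 h1 (hsum k)]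
      ring
  have hs := summable_e h0 h1 hy hy1
  have hlim : Tendsto (fun m : ℕ => q ^ m * y) atTop (nhds 0) := by
    simpa using (tendsto_pow_atTop_nhds_zero_of_lt_one h0.le h1).mul_const y
  have L1 : Tendsto (fun m : ℕ => qExp q (q ^ m * y)) atTop (nhds (qExp q 0)) := by
    refine tendsto_tsum_of_dominated_convergence hs ?_ ?_
    · intro k
      exact (hlim.pow k).div_const _
    · refine Eventually.of_forall fun m k => ?_
      have := qFact_pos h0 h1 k
      have h2 := hz m
      rw [Real.norm_of_nonneg (div_nonneg (pow_nonneg h2.1 _) this.le)]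
      have := h2.2
      have := h2.1
      gcongr
  have L2 : Tendsto (fun m : ℕ => qExpE q (-(q ^ m * y))) atTop (nhds (qExpE q (-0))) := by
    refine tendsto_tsum_of_dominated_convergence hs ?_ ?_
    · intro k
      exact ((hlim.neg.pow k).const_mul _).div_const _
    · refine Eventually.of_forall fun m k => ?_
      have := qFact_pos h0 h1 k
      have h2 := hz m
      rw [norm_div, norm_mul, norm_pow, norm_pow, norm_neg, Real.norm_of_nonneg h0.le,
        Real.norm_of_nonneg h2.1, Real.norm_of_nonneg this.le]
      have := h2.2
      have := h2.1
      gcongr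
      exact (mul_le_of_le_one_left (by positivity) (pow_le_one₀ h0.le h1.le)).trans (by gcongr)
  have hz0 : qExp q 0 = 1 := by
    unfold qExp
    rw [tsum_eq_single 0]
    · simp [qFact_zero]
    · intro b hb; simp [hb]
  have hz1 : qExpE q (-0) = 1 := by
    unfold qExpE
    rw [tsum_eq_single 0]
    · simp [qFact_zero]
    · intro b hb; simp [hb]
  have := L2.mul L1
  simp_rw [hconst] at this
  rw [hz0, hz1, mul_one] at this
  exact tendsto_nhds_unique tendsto_const_nhds this

/-- Rearrangement of the operator series as a double series. -/
lemma rearr (c e F : ℕ → ℝ) (hs : Summable fun p : ℕ × ℕ => c p.1 * e p.2 * F (p.1 + p.2)) :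
    ∑' k, (∑ j ∈ Finset.range (k + 1), c j * e (k - j)) * F k
      = ∑' p : ℕ × ℕ, c p.1 * e p.2 * F (p.1 + p.2) := by
  have h2 : Summable fun x : (Σ n : ℕ, Finset.HasAntidiagonal.antidiagonal n) =>
      c (x.2 : ℕ × ℕ).1 * e (x.2 : ℕ × ℕ).2 * F ((x.2 : ℕ × ℕ).1 + (x.2 : ℕ × ℕ).2) :=
    Finset.HasAntidiagonal.sigmaAntidiagonalEquivProd.summable_iff.2 hs
  rw [← Finset.HasAntidiagonal.sigmaAntidiagonalEquivProd.tsum_eq]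
  rw [show (∑' x, (fun p : ℕ × ℕ => c p.1 * e p.2 * F (p.1 + p.2))
    (Finset.HasAntidiagonal.sigmaAntidiagonalEquivProd x)) = _ from h2.tsum_sigma' (fun n => (hasSum_fintype _).summable)]
  congr 1
  ext k
  rw [tsum_fintype, Finset.sum_mul, Finset.univ_eq_attach]
  change _ = ∑ x ∈ (Finset.HasAntidiagonal.antidiagonal k).attach,
    c (x : ℕ × ℕ).1 * e (x : ℕ × ℕ).2 * F ((x : ℕ × ℕ).1 + (x : ℕ × ℕ).2)
  rw [Finset.sum_attach (Finset.HasAntidiagonal.antidiagonal k) (fun p => c p.1 * e p.2 * F (p.1 + p.2)),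
    Finset.Nat.sum_antidiagonal_eq_sum_range_succ_mk]
  refine Finset.sum_congr rfl fun j hj => ?_
  have : j + (k - j) = k := by have := Finset.mem_range.1 hj; omega
  simp [this]

lemma modulus {a : ℝ} {f : ℝ → ℝ} (hfc : ContinuousOn f (Set.Ici 0)) {M : ℝ}
    (hM : ∀ u : ℝ, 0 ≤ u → |f u| ≤ M) {ε : ℝ} (hε : 0 < ε) :
    ∃ K, 0 ≤ K ∧ ∀ u v, 0 ≤ u → u ≤ 2 * a → 0 ≤ v → |f v - f u| ≤ ε + K * (v - u) ^ 2 := by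
  have hu : UniformContinuousOn f (Set.Icc 0 (2 * a + 1)) :=
    isCompact_Icc.uniformContinuousOn_of_continuous (hfc.mono fun x hx => hx.1)
  obtain ⟨δ, hδ, h⟩ := Metric.uniformContinuousOn_iff.1 hu ε hε
  have hM0 : 0 ≤ M := (abs_nonneg _).trans (hM 0 le_rfl)
  have hm : 0 < min δ 1 := lt_min hδ one_pos
  refine ⟨2 * M / (min δ 1) ^ 2, by positivity, ?_⟩
  intro u v hu0 hu1 hv
  by_cases hd : |v - u| < min δ 1
  · have h1 : |v - u| < 1 := hd.trans_le (min_le_right _ _)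
    have h2 : |v - u| < δ := hd.trans_le (min_le_left _ _)
    have := h v ⟨hv, by linarith [(abs_lt.1 h1).2]⟩ u ⟨hu0, by linarith⟩ h2
    rw [Real.dist_eq] at this
    have : 0 ≤ 2 * M / (min δ 1) ^ 2 * (v - u) ^ 2 := by positivity
    linarith
  · push Not at hd
    have h1 : (min δ 1) ^ 2 ≤ (v - u) ^ 2 := by
      rw [← sq_abs (v - u)]; gcongr
    have h2 : |f v - f u| ≤ 2 * M := by
      have := abs_sub (f v) (f u)
      linarith [hM v hv, hM u hu0]
    have h3 : 2 * M ≤ 2 * M / (min δ 1) ^ 2 * (v - u) ^ 2 := by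
      rw [div_mul_eq_mul_div, le_div_iff₀ (by positivity)]
      gcongr
    linarith

lemma main_bound {c : ℕ → ℝ} (hc : ∀ k, 0 ≤ c k) (hA1 : 0 < APow c 1)
    (hcs : Summable c) (hcs2 : Summable fun k : ℕ => (k : ℝ) ^ 2 * c k)
    {α β a : ℝ} (hα : 0 ≤ α) (hβ : 0 ≤ β) {f : ℝ → ℝ} {M : ℝ}
    (hM : ∀ u : ℝ, 0 ≤ u → |f u| ≤ M) {ε K : ℝ} (hK : 0 ≤ K)
    (hf : ∀ u v, 0 ≤ u → u ≤ 2 * a → 0 ≤ v → |f v - f u| ≤ ε + K * (v - u) ^ 2)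
    {q : ℝ} (h0 : 0 < q) (h1 : q < 1) {n : ℕ} (hn : 0 < qInt q n) (hqa : (1 - q ^ n) * a < 1)
    {x t : ℝ} (hx : x ∈ Set.Icc 0 a) (ht : t ∈ Set.Icc 0 a) :
    |Tq c q n t α β f x - f (x + t)| ≤ ε + 3 * K / qInt q n ^ 2 *
      (qInt q n * a + (∑' k : ℕ, (k : ℝ) ^ 2 * c k) / APow c 1 + (α + a * β) ^ 2) := by
  obtain ⟨hx0, hxa⟩ := hx
  obtain ⟨ht0, hta⟩ := ht
  set y := qInt q n * t with hy
  set N := qInt q n with hN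
  have hy0 : 0 ≤ y := by positivity
  have hy1 : (1 - q) * y < 1 := by
    have h3 : (1 - q) * N = 1 - q ^ n := by
      have : (1 - q) ≠ 0 := by linarith
      rw [hN]; unfold qInt; field_simp
    have h4 : 0 ≤ 1 - q ^ n := sub_nonneg.2 (pow_le_one₀ h0.le h1.le)
    rw [hy, ← mul_assoc, h3]
    exact lt_of_le_of_lt (by gcongr) hqa
  have hs := summable_e h0 h1 hy0 hy1
  have hEe := E_mul_e h0 h1 hy0 hy1
  have hS := hs.hasSum
  set e : ℕ → ℝ := fun m => y ^ m / qFact q m with he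
  have he0 : ∀ m, 0 ≤ e m := fun m => div_nonneg (pow_nonneg hy0 m) (qFact_pos h0 h1 m).le
  change HasSum e (qExp q y) at hS
  have hSpos : 0 < qExp q y := by
    have h5 : e 0 ≤ qExp q y := hs.le_tsum 0 fun i _ => he0 i
    have : e 0 = 1 := by simp [he, qFact_zero]
    linarith
  set S := qExp q y with hSdef
  set E := qExpE q (-y) with hE
  have hEpos : 0 < E := by
    by_contra h; push Not at h; nlinarith
  have hA : HasSum c (APow c 1) := by
    have := hcs.hasSum
    simpa [APow] using this
  set A := APow c 1 with hAdef
  set Q := ∑' k : ℕ, (k : ℝ) ^ 2 * c k with hQ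
  have hQs : HasSum (fun k : ℕ => (k : ℝ) ^ 2 * c k) Q := hcs2.hasSum
  have hV := var h0 h1 hS
  have P : ∀ {g h : ℕ → ℝ} {s r : ℝ}, (∀ k, 0 ≤ g k) → (∀ k, 0 ≤ h k) → HasSum g s → HasSum h r →
      HasSum (fun p : ℕ × ℕ => g p.1 * h p.2) (s * r) := by
    intro g h s r hg hh h1 h2
    exact h1.mul h2 (h1.summable.mul_of_nonneg h2.summable hg hh)
  have W := P hc he0 hA hS
  have W2 := P (fun k => mul_nonneg (sq_nonneg _) (hc k)) he0 hQs hS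
  have W3 := P hc (fun k => mul_nonneg (sq_nonneg _) (he0 k)) hA hV
  set F : ℕ → ℝ := fun k => f (x + (qInt q k + α) / (N + β)) with hF
  have hv0 : ∀ k, 0 ≤ x + (qInt q k + α) / (N + β) := fun k => by
    have := qInt_nonneg h0 h1 k
    positivity
  have hFs : Summable fun p : ℕ × ℕ => c p.1 * e p.2 * F (p.1 + p.2) := by
    refine Summable.of_norm_bounded (W.summable.mul_right M) ?_
    intro p
    rw [norm_mul, Real.norm_of_nonneg (mul_nonneg (hc _) (he0 _))]
    exact mul_le_mul_of_nonneg_left (hM _ (hv0 _)) (mul_nonneg (hc _) (he0 _))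
  have hT : Tq c q n t α β f x = E / A * ∑' p : ℕ × ℕ, c p.1 * e p.2 * F (p.1 + p.2) := by
    rw [← rearr c e F hFs]
    unfold Tq
    congr 1
    refine tsum_congr fun k => ?_
    have := (qFact_pos h0 h1 k).ne'
    unfold qAppell
    rw [mul_div_cancel_left₀ _ this]
    simp only [hF, he, mul_div_assoc]
    rfl
  have hD := hFs.hasSum.sub (W.mul_right (f (x + t)))
  have hTd : Tq c q n t α β f x - f (x + t) = E / A *
      ∑' p : ℕ × ℕ, (c p.1 * e p.2 * F (p.1 + p.2) - c p.1 * e p.2 * f (x + t)) := by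
    rw [hD.tsum_eq, hT, mul_sub]
    congr 1
    have hE1 : E * S = 1 := hEe
    field_simp
    linear_combination (-f (x + t)) * hE1
  have hB := ((W.mul_left ε).add (((W3.add W2).add (W.mul_left ((α + a * β) ^ 2))).mul_left
    (3 * K / N ^ 2)))
  have hle : ‖∑' p : ℕ × ℕ, (c p.1 * e p.2 * F (p.1 + p.2) - c p.1 * e p.2 * f (x + t))‖ ≤
      ε * (A * S) + 3 * K / N ^ 2 * (A * ((y - (1 - q) * y ^ 2) * S) + Q * S
      + (α + a * β) ^ 2 * (A * S)) := by
    refine tsum_of_norm_bounded hB ?_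
    rintro ⟨j, m⟩
    simp only
    rw [← mul_sub, norm_mul, Real.norm_of_nonneg (mul_nonneg (hc _) (he0 _)), Real.norm_eq_abs]
    have hw : 0 ≤ c j * e m := mul_nonneg (hc _) (he0 _)
    have hjN := qInt_nonneg h0 h1 j
    have key : |F (j + m) - f (x + t)| ≤ ε + 3 * K / N ^ 2 *
        ((qInt q m - y) ^ 2 + (j : ℝ) ^ 2 + (α + a * β) ^ 2) := by
      refine (hf (x + t) _ (by positivity) (by linarith) (hv0 (j + m))).trans ?_
      have e1 : x + (qInt q (j + m) + α) / (N + β) - (x + t)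
          = ((qInt q m - y) + q ^ m * qInt q j + (α - t * β)) / (N + β) := by
        rw [qInt_add h1, hy]; field_simp; ring
      rw [e1, div_pow]
      have b1 : (q ^ m * qInt q j) ^ 2 ≤ (j : ℝ) ^ 2 := by
        have : q ^ m * qInt q j ≤ j :=
          (mul_le_of_le_one_left hjN (pow_le_one₀ h0.le h1.le)).trans (qInt_le h0 h1 j)
        gcongr
      have b2 : (α - t * β) ^ 2 ≤ (α + a * β) ^ 2 := by
        have : t * β ≤ a * β := by gcongr
        have : 0 ≤ t * β := by positivity
        apply sq_le_sq'  <;> linarith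
      have b3 : ∀ X Y Z : ℝ, (X + Y + Z) ^ 2 ≤ 3 * (X ^ 2 + Y ^ 2 + Z ^ 2) := by
        intro X Y Z
        nlinarith [sq_nonneg (X - Y), sq_nonneg (Y - Z), sq_nonneg (X - Z)]
      have b4 : ((qInt q m - y) + q ^ m * qInt q j + (α - t * β)) ^ 2 / (N + β) ^ 2
          ≤ 3 * ((qInt q m - y) ^ 2 + (j : ℝ) ^ 2 + (α + a * β) ^ 2) / N ^ 2 := by
        gcongr
        · exact (b3 _ _ _).trans (by linarith)
        · linarith
      calc _ ≤ ε + K * (3 * ((qInt q m - y) ^ 2 + (j : ℝ) ^ 2 + (α + a * β) ^ 2) / N ^ 2) := by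
            gcongr
        _ = _ := by ring
    refine (mul_le_mul_of_nonneg_left key hw).trans (le_of_eq ?_)
    ring
  rw [hTd, abs_mul, abs_of_pos (div_pos hEpos hA1)]
  rw [Real.norm_eq_abs] at hle
  refine (mul_le_mul_of_nonneg_left hle (div_pos hEpos hA1).le).trans ?_
  have hE1 : E = 1 / S := by
    rw [eq_div_iff hSpos.ne']; exact hEe
  have : E / A * (ε * (A * S) + 3 * K / N ^ 2 * (A * ((y - (1 - q) * y ^ 2) * S) + Q * S
      + (α + a * β) ^ 2 * (A * S))) = ε + 3 * K / N ^ 2 * ((y - (1 - q) * y ^ 2) + Q / A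
      + (α + a * β) ^ 2) := by
    rw [hE1]; field_simp
  rw [this]
  have : y - (1 - q) * y ^ 2 ≤ N * a := by
    have h6 : y ≤ N * a := by rw [hy]; gcongr
    have : 0 ≤ (1 - q) * y ^ 2 := mul_nonneg (by linarith) (sq_nonneg _)
    linarith
  gcongr

lemma stat_of_imp {x y z : ℕ → ℝ} {l m r : ℝ} (hx : StatLim x l) (hy : StatLim y m)
    (H : ∀ ε > 0, ∃ δ > 0, ∃ η > 0, ∀ n, |x n - l| < δ → |y n - m| < η → |z n - r| < ε) :
    StatLim z r := by
  intro ε hε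
  obtain ⟨δ, hδ, η, hη, h⟩ := H ε hε
  have hsum := (hx δ hδ).add (hy η hη)
  rw [add_zero] at hsum
  refine squeeze_zero (fun n => by positivity) (fun n => ?_) hsum
  rw [← add_div]
  gcongr
  rw [← Nat.cast_add]
  refine Nat.cast_le.2 ((Finset.card_le_card ?_).trans (Finset.card_union_le _ _))
  intro k hk
  simp only [Finset.mem_filter, Finset.mem_union] at hk ⊢
  by_contra hcon
  have h1 : |x k - l| < δ := by
    by_contra h'; exact hcon (Or.inl ⟨hk.1, not_lt.1 h'⟩)
  have h2 : |y k - m| < η := by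
    by_contra h'; exact hcon (Or.inr ⟨hk.1, not_lt.1 h'⟩)
  exact absurd hk.2 (not_le.2 (h k h1 h2))

lemma summable_sq {c : ℕ → ℝ} (hc : ∀ k, 0 ≤ c k) {R : ℝ} (hR : 1 < R)
    (hs : Summable fun k => c k * R ^ k) :
    Summable c ∧ Summable fun k : ℕ => (k : ℝ) ^ 2 * c k := by
  have hp : ∀ k : ℕ, 1 ≤ R ^ k := fun k => one_le_pow₀ hR.le
  refine ⟨Summable.of_nonneg_of_le hc (fun k => ?_) hs, ?_⟩
  · exact le_mul_of_one_le_right (hc k) (hp k)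
  · have hq : ∀ k : ℕ, (k : ℝ) ≤ (R ^ k) / (R - 1) := by
      intro k
      rw [le_div_iff₀ (by linarith)]
      have := one_add_mul_sub_le_pow (a := R) (by linarith) k
      linarith
    have ht : Tendsto (fun k : ℕ => (k : ℝ) ^ 2 / R ^ k) atTop (nhds 0) :=
      tendsto_pow_const_div_const_pow_of_one_lt 2 hR
    obtain ⟨B, hB⟩ := ht.bddAbove_range
    refine Summable.of_nonneg_of_le (fun k => mul_nonneg (sq_nonneg _) (hc k)) (fun k => ?_)
      (hs.mul_left B)
    have h1 : (k : ℝ) ^ 2 / R ^ k ≤ B := hB ⟨k, rfl⟩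
    rw [div_le_iff₀ (by linarith [hp k])] at h1
    calc _ ≤ B * R ^ k * c k := mul_le_mul_of_nonneg_right h1 (hc k)
      _ = _ := by ring

end QAux

/-- Korovkin-type statistical approximation: for bounded continuous `f`,
    `st-lim_n sup_{x,t ∈ [0,a]} |T_{n,t}^{α,β}(f;qₙ;x) − f(x+t)| = 0`. -/
theorem stmt_9 (c : ℕ → ℝ) (hc : ∀ k, 0 ≤ c k)
    (hrad : ∃ R : ℝ, 1 < R ∧ Summable fun k => c k * R ^ k) (hA1 : 0 < APow c 1)
    (α β : ℝ) (hα : 0 ≤ α) (hβ : 0 ≤ β) (a : ℝ) (ha : 0 < a)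
    (qs : ℕ → ℝ) (hqs : ∀ n, 0 < qs n ∧ qs n < 1)
    (hqa : ∀ n, (1 - qs n ^ n) * a < 1)
    (hst1 : StatLim qs 1) (b : ℝ) (hb : b < 1)
    (hst2 : StatLim (fun n => qs n ^ n) b)
    (f : ℝ → ℝ) (hfc : ContinuousOn f (Set.Ici 0))
    (hfb : ∃ M : ℝ, ∀ u : ℝ, 0 ≤ u → |f u| ≤ M) :
    StatLim (fun n => sSup {r : ℝ | ∃ x t : ℝ, x ∈ Set.Icc 0 a ∧ t ∈ Set.Icc 0 a ∧
      r = |Tq c (qs n) n t α β f x - f (x + t)|}) 0 := by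
  obtain ⟨R, hR, hRs⟩ := hrad
  obtain ⟨M, hM⟩ := hfb
  obtain ⟨hcs, hcs2⟩ := QAux.summable_sq hc hR hRs
  refine QAux.stat_of_imp hst1 hst2 ?_
  intro ε hε
  obtain ⟨K, hK, hf⟩ := QAux.modulus (a := a) hfc hM (ε := ε / 4) (by positivity)
  set Q := ∑' k : ℕ, (k : ℝ) ^ 2 * c k with hQ
  have hQ0 : 0 ≤ Q := tsum_nonneg fun k => mul_nonneg (sq_nonneg _) (hc k)
  set C := 3 * K * (a + Q / APow c 1 + (α + a * β) ^ 2) with hC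
  have hC0 : 0 ≤ C := by positivity
  set N0 := 1 + 4 * C / ε with hN0
  have hN01 : 1 ≤ N0 := by
    have : 0 ≤ 4 * C / ε := by positivity
    linarith
  refine ⟨(1 - b) / 2 / N0, by apply div_pos <;> linarith, (1 - b) / 2, by linarith, ?_⟩
  intro n h1 h2
  obtain ⟨hq0, hq1⟩ := hqs n
  have hN : N0 ≤ qInt (qs n) n := by
    unfold qInt
    rw [le_div_iff₀ (by linarith)]
    have h3 := (abs_lt.1 h1).1
    have h4 := (abs_lt.1 h2).2
    have h5 : 1 - qs n < (1 - b) / 2 / N0 := by linarith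
    rw [lt_div_iff₀ (by linarith)] at h5
    nlinarith
  have hNpos : 0 < qInt (qs n) n := by linarith
  have hNone : 1 ≤ qInt (qs n) n := by linarith
  have hbound : sSup {r : ℝ | ∃ x t : ℝ, x ∈ Set.Icc 0 a ∧ t ∈ Set.Icc 0 a ∧
      r = |Tq c (qs n) n t α β f x - f (x + t)|} ≤ ε / 2 := by
    refine Real.sSup_le ?_ (by positivity)
    rintro r ⟨x, t, hx, ht, rfl⟩
    refine (QAux.main_bound hc hA1 hcs hcs2 hα hβ hM hK hf hq0 hq1 hNpos (hqa n) hx ht).trans ?_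
    rw [← hQ]
    set N := qInt (qs n) n with hNdef
    have hq' : 0 ≤ Q / APow c 1 + (α + a * β) ^ 2 := by positivity
    have s1 : N * a + Q / APow c 1 + (α + a * β) ^ 2 ≤
        N * (a + Q / APow c 1 + (α + a * β) ^ 2) := by nlinarith
    have s2 : 3 * K / N ^ 2 * (N * a + Q / APow c 1 + (α + a * β) ^ 2) ≤ C / N := by
      calc _ ≤ 3 * K / N ^ 2 * (N * (a + Q / APow c 1 + (α + a * β) ^ 2)) := by gcongr
        _ = C / N := by rw [hC]; field_simp
    have s3 : C / N ≤ ε / 4 := by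
      rw [div_le_iff₀ hNpos]
      have : ε / 4 * N0 ≤ ε / 4 * N := by gcongr
      have e : ε / 4 * N0 = ε / 4 + C := by rw [hN0]; field_simp
      linarith
    linarith
  have hnn : 0 ≤ sSup {r : ℝ | ∃ x t : ℝ, x ∈ Set.Icc 0 a ∧ t ∈ Set.Icc 0 a ∧
      r = |Tq c (qs n) n t α β f x - f (x + t)|} := by
    refine Real.sSup_nonneg ?_
    rintro r ⟨x, t, hx, ht, rfl⟩
    exact abs_nonneg _
  rw [sub_zero, abs_of_nonneg hnn]
  linarith
end

section
/- Let α, β ≥ 0, let n ≥ 1 be an integer, and let t ≥ 0 satisfy (1-q^n)·t < 1. Then for every bounded uniformly continuous function f : [0,∞) → ℝ and every x ≥ 0, |T_{n,t}^{α,β}(f;q;x) − f(x+t)| ≤ 2·ω(f, √δ_{n,t}(x)), where δ_{n,t}(x) = T_{n,t}^{α,β}(s ↦ (s − (x+t))²; q; x) is the second central moment of the operator about x+t. -/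
open Filter

lemma aux_qInt_pos {q : ℝ} (h0 : 0 < q) (h1 : q < 1) (k : ℕ) : 0 < qInt q (k+1) := by
  unfold qInt
  have : q ^ (k+1) < 1 := pow_lt_one₀ h0.le h1 (by omega)
  exact div_pos (by linarith) (by linarith)

lemma aux_qInt_nonneg {q : ℝ} (h0 : 0 < q) (h1 : q < 1) (k : ℕ) : 0 ≤ qInt q k := by
  unfold qInt
  have : q ^ k ≤ 1 := pow_le_one₀ h0.le h1.le
  exact div_nonneg (by linarith) (by linarith)

lemma aux_qInt_le {q : ℝ} (h0 : 0 < q) (h1 : q < 1) (k : ℕ) : qInt q k ≤ 1 / (1 - q) := by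
  unfold qInt
  have : 0 < q ^ k := pow_pos h0 k
  exact div_le_div_of_nonneg_right (by linarith) (by linarith)

lemma aux_qFact_pos {q : ℝ} (h0 : 0 < q) (h1 : q < 1) (k : ℕ) : 0 < qFact q k :=
  Finset.prod_pos fun i _ => aux_qInt_pos h0 h1 i

lemma aux_qFact_succ (q : ℝ) (k : ℕ) : qFact q (k+1) = qFact q k * qInt q (k+1) := by
  unfold qFact
  rw [Finset.prod_range_succ]

lemma aux_qInt_add {q : ℝ} (h1 : q < 1) (i j : ℕ) :
    qInt q (i + j) = qInt q i + q ^ i * qInt q j := by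
  unfold qInt
  have : 1 - q ≠ 0 := by linarith
  field_simp
  ring

lemma aux_summable_b {q : ℝ} (h0 : 0 < q) (h1 : q < 1) {y : ℝ} (hy : 0 ≤ y)
    (hy1 : (1 - q) * y < 1) : Summable fun k => y ^ k / qFact q k := by
  obtain ⟨r, hr, hr1⟩ := exists_between hy1
  have hr0 : 0 < r := lt_of_le_of_lt (mul_nonneg (by linarith) hy) hr
  have hlim : Tendsto (fun k : ℕ => r * (1 - q ^ (k+1))) atTop (nhds (r * (1 - 0))) :=
    ((tendsto_const_nhds.sub ((tendsto_add_atTop_iff_nat 1).2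
      (tendsto_pow_atTop_nhds_zero_of_lt_one h0.le h1))).const_mul r)
  have hev := hlim.eventually (lt_mem_nhds (show (1 - q) * y < r * (1 - 0) by linarith))
  refine summable_of_ratio_norm_eventually_le hr1 ?_
  filter_upwards [hev] with k hk
  have hf := aux_qFact_pos h0 h1 k
  have hi := aux_qInt_pos h0 h1 k
  have hyr : y ≤ r * qInt q (k+1) := by
    unfold qInt
    rw [← mul_div_assoc, le_div_iff₀ (by linarith)]
    linarith
  have h2 : 0 ≤ y ^ k / qFact q k := by positivity
  rw [Real.norm_of_nonneg (div_nonneg (by positivity) (aux_qFact_pos h0 h1 (k+1)).le),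
    Real.norm_of_nonneg h2, aux_qFact_succ, pow_succ, mul_div_mul_comm, mul_comm]
  apply mul_le_mul_of_nonneg_right _ h2
  rw [div_le_iff₀ hi]; exact hyr

lemma aux_key {q : ℝ} (h0 : 0 < q) (h1 : q < 1) (y : ℝ) (m : ℕ) :
    ∑ p ∈ Finset.HasAntidiagonal.antidiagonal (m+1),
      (q ^ (p.1 * (p.1 - 1) / 2) * (-y) ^ p.1 / qFact q p.1) * (y ^ p.2 / qFact q p.2) = 0 := by
  set a : ℕ → ℝ := fun j => q ^ (j * (j - 1) / 2) * (-y) ^ j / qFact q j with ha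
  set b : ℕ → ℝ := fun j => y ^ j / qFact q j with hb
  have ra : ∀ j, qInt q (j+1) * a (j+1) = -(y * q ^ j * a j) := by
    intro j
    have := (aux_qFact_pos h0 h1 j).ne'
    have := (aux_qInt_pos h0 h1 j).ne'
    simp only [ha]
    rw [Nat.triangle_succ, aux_qFact_succ, pow_add, pow_succ]
    field_simp
  have rb : ∀ j, qInt q (j+1) * b (j+1) = y * b j := by
    intro j
    have := (aux_qFact_pos h0 h1 j).ne'
    have := (aux_qInt_pos h0 h1 j).ne'
    simp only [hb]
    rw [aux_qFact_succ, pow_succ]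
    field_simp
  have z : qInt q 0 = 0 := by simp [qInt]
  have hm := aux_qInt_pos h0 h1 m
  have : qInt q (m+1) * ∑ p ∈ Finset.HasAntidiagonal.antidiagonal (m+1), a p.1 * b p.2 = 0 := by
    have e : qInt q (m+1) * ∑ p ∈ Finset.HasAntidiagonal.antidiagonal (m+1), a p.1 * b p.2 =
        ∑ p ∈ Finset.HasAntidiagonal.antidiagonal (m+1), (qInt q p.1 * a p.1) * b p.2 +
        ∑ p ∈ Finset.HasAntidiagonal.antidiagonal (m+1), q ^ p.1 * a p.1 * (qInt q p.2 * b p.2) := by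
      rw [Finset.mul_sum, ← Finset.sum_add_distrib]
      refine Finset.sum_congr rfl fun p hp => ?_
      rw [← Finset.HasAntidiagonal.mem_antidiagonal.1 hp, aux_qInt_add h1]
      ring
    rw [e, Finset.Nat.sum_antidiagonal_succ, Finset.Nat.sum_antidiagonal_succ']
    simp only [ra, rb, z, zero_mul, mul_zero, zero_add, add_zero]
    rw [← Finset.sum_add_distrib]
    exact Finset.sum_eq_zero fun p _ => by ring
  exact (mul_eq_zero.1 this).resolve_left hm.ne'

lemma aux_inv {q : ℝ} (h0 : 0 < q) (h1 : q < 1) {y : ℝ} (hy : 0 ≤ y)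
    (hy1 : (1 - q) * y < 1) : qExpE q (-y) * qExp q y = 1 := by
  have sb := aux_summable_b h0 h1 hy hy1
  have sbn : Summable fun k => ‖y ^ k / qFact q k‖ := sb.norm
  have sa : Summable fun k => ‖q ^ (k * (k - 1) / 2) * (-y) ^ k / qFact q k‖ := by
    refine Summable.of_nonneg_of_le (fun _ => norm_nonneg _) (fun k => ?_) sbn
    rw [norm_div, norm_div, norm_mul]
    apply div_le_div_of_nonneg_right _ (norm_nonneg _)
    rw [norm_pow (-y), norm_neg, ← norm_pow y]
    apply mul_le_of_le_one_left (norm_nonneg _)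
    rw [Real.norm_of_nonneg (by positivity)]
    exact pow_le_one₀ h0.le h1.le
  unfold qExpE qExp
  rw [tsum_mul_tsum_eq_tsum_sum_antidiagonal_of_summable_norm sa sbn, tsum_eq_single 0]
  · simp [qFact]
  · intro m hm
    obtain ⟨k, rfl⟩ := Nat.exists_eq_succ_of_ne_zero hm
    exact aux_key h0 h1 y k

lemma aux_mod_le {f : ℝ → ℝ} {M : ℝ} (hM : ∀ u, 0 ≤ u → |f u| ≤ M) {δ u v : ℝ}
    (hu : 0 ≤ u) (hv : 0 ≤ v) (h : |u - v| ≤ δ) : |f u - f v| ≤ modCont f δ := by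
  apply le_csSup
  · refine ⟨M + M, ?_⟩
    rintro r ⟨u, v, hu, hv, -, rfl⟩
    exact (abs_sub _ _).trans (add_le_add (hM u hu) (hM v hv))
  · exact ⟨u, v, hu, hv, h, rfl⟩

lemma aux_mod_nat {f : ℝ → ℝ} {M : ℝ} (hM : ∀ u, 0 ≤ u → |f u| ≤ M) {δ v : ℝ}
    (hv : 0 ≤ v) (m : ℕ) : ∀ u, 0 ≤ u → |u - v| ≤ m * δ → |f u - f v| ≤ m * modCont f δ := by
  induction m with
  | zero =>
    intro u hu h
    have : u - v = 0 := abs_eq_zero.1 (le_antisymm (by simpa using h) (abs_nonneg _))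
    rw [sub_eq_zero.1 this]; simp
  | succ m ih =>
    intro u hu h
    push_cast at h ⊢
    have hm : (0:ℝ) < m + 1 := by positivity
    set w := v + (u - v) * (m / (m + 1)) with hw
    have hw0 : 0 ≤ w := by
      have : w = (v + u * m) / (m + 1) := by rw [hw]; field_simp; ring
      rw [this]; positivity
    have hd : |u - v| / (m+1) ≤ δ := by rw [div_le_iff₀ hm]; linarith
    have e1 : |u - w| ≤ δ := by
      have : u - w = (u - v) / (m + 1) := by rw [hw]; field_simp; ring
      rw [this, abs_div, abs_of_pos hm]; exact hd
    have e2 : |w - v| ≤ m * δ := by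
      have : w - v = m * ((u - v) / (m + 1)) := by rw [hw]; field_simp; ring
      rw [this, abs_mul, abs_div, abs_of_pos hm, Nat.abs_cast]
      exact mul_le_mul_of_nonneg_left hd (by positivity)
    have := abs_sub_le (f u) (f w) (f v)
    have := aux_mod_le hM hu hw0 e1
    have := ih w hw0 e2
    linarith

lemma aux_mod_sq {f : ℝ → ℝ} {M : ℝ} (hM : ∀ u, 0 ≤ u → |f u| ≤ M) {δ u v : ℝ}
    (hδ : 0 < δ) (hu : 0 ≤ u) (hv : 0 ≤ v) :
    |f u - f v| ≤ (1 + (u - v) ^ 2 / δ ^ 2) * modCont f δ := by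
  have hω : 0 ≤ modCont f δ := by
    have := aux_mod_le hM (δ := δ) hu hu (by simpa using hδ.le)
    exact (abs_nonneg _).trans this
  set l := |u - v| / δ with hl
  have hl0 : 0 ≤ l := by positivity
  have hlsq : (u - v) ^ 2 / δ ^ 2 = l ^ 2 := by rw [hl, div_pow, sq_abs]
  have h1 : |u - v| ≤ ((⌊l⌋₊ + 1 : ℕ) : ℝ) * δ := by
    rw [← div_le_iff₀ hδ]; push_cast; exact (Nat.lt_floor_add_one l).le
  refine (aux_mod_nat hM hv _ u hu h1).trans (mul_le_mul_of_nonneg_right ?_ hω)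
  rw [hlsq]; push_cast
  have h2 : (⌊l⌋₊ : ℝ) ≤ l := Nat.floor_le hl0
  rcases Nat.eq_zero_or_pos ⌊l⌋₊ with h | h
  · rw [h]; simp; positivity
  · have : (1:ℝ) ≤ ⌊l⌋₊ := by exact_mod_cast h
    nlinarith

lemma aux_abs {f : ℝ → ℝ} {M : ℝ} (hM : ∀ u, 0 ≤ u → |f u| ≤ M) (p s : ℕ → ℝ)
    (hp : ∀ k, 0 ≤ p k) (hs : HasSum p 1) (s0 : ∀ k, 0 ≤ s k) {B v : ℝ} (sB : ∀ k, s k ≤ B)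
    (hv : 0 ≤ v) :
    |∑' k, p k * f (s k) - f v| ≤ 2 * modCont f (Real.sqrt (∑' k, p k * (s k - v) ^ 2)) := by
  have S1 : Summable fun k => p k * f (s k) := by
    refine Summable.of_norm_bounded (hs.summable.mul_right M) fun k => ?_
    rw [norm_mul, Real.norm_of_nonneg (hp k)]
    exact mul_le_mul_of_nonneg_left (hM _ (s0 k)) (hp k)
  have S2 : Summable fun k => p k * (s k - v) ^ 2 := by
    refine Summable.of_norm_bounded (hs.summable.mul_right ((B + v) ^ 2)) fun k => ?_
    rw [norm_mul, Real.norm_of_nonneg (hp k), Real.norm_of_nonneg (sq_nonneg _)]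
    apply mul_le_mul_of_nonneg_left _ (hp k)
    have := s0 k
    have := sB k
    apply sq_le_sq'  <;> linarith
  set D := ∑' k, p k * (s k - v) ^ 2 with hD
  have D0 : 0 ≤ D := tsum_nonneg fun k => mul_nonneg (hp k) (sq_nonneg _)
  have hω : 0 ≤ modCont f (Real.sqrt D) :=
    (abs_nonneg _).trans (aux_mod_le hM hv hv (by simp))
  have H : HasSum (fun k => p k * (f (s k) - f v)) (∑' k, p k * f (s k) - f v) := by
    have := S1.hasSum.sub (hs.mul_right (f v))
    simpa [mul_sub] using this
  rcases D0.eq_or_lt with h | h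
  · have hz := (hasSum_zero_iff_of_nonneg
      (fun k => mul_nonneg (hp k) (sq_nonneg (s k - v)))).1 (by rw [h]; exact S2.hasSum)
    have : (fun k => p k * (f (s k) - f v)) = fun _ => 0 := by
      funext k
      have := congrFun hz k
      simp only [Pi.zero_apply, mul_eq_zero] at this
      rcases this with h | h
      · simp [h]
      · have : s k = v := sub_eq_zero.1 (pow_eq_zero_iff (two_ne_zero) |>.1 h)
        simp [this]
    rw [this] at H
    rw [H.unique hasSum_zero]; simpa using hω
  · have h' := Real.sqrt_pos.2 h
    have G : HasSum (fun k => (p k + p k * (s k - v) ^ 2 / D) * modCont f (Real.sqrt D))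
        ((1 + D / D) * modCont f (Real.sqrt D)) :=
      (hs.add (S2.hasSum.div_const D)).mul_right _
    rw [div_self h.ne'] at G
    have bd : ∀ k, |p k * (f (s k) - f v)| ≤
        (p k + p k * (s k - v) ^ 2 / D) * modCont f (Real.sqrt D) := by
      intro k
      rw [abs_mul, abs_of_nonneg (hp k)]
      have := mul_le_mul_of_nonneg_left (aux_mod_sq hM h' (s0 k) hv) (hp k)
      rw [Real.sq_sqrt D0] at this
      refine this.trans (le_of_eq (by ring))
    rw [abs_le]
    constructor
    · have := hasSum_le (fun k => neg_le_of_abs_le (bd k)) G.neg H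
      linarith
    · have := hasSum_le (fun k => le_of_abs_le (bd k)) H G
      linarith

/-- `|T_{n,t}^{α,β}(f;q;x) − f(x+t)| ≤ 2 ω(f, √δ_{n,t}(x))` where
    `δ_{n,t}(x)` is the second central moment about `x+t`. -/
theorem stmt_10 (q : ℝ) (hq0 : 0 < q) (hq1 : q < 1)
    (c : ℕ → ℝ) (hc : ∀ k, 0 ≤ c k)
    (hrad : ∃ R : ℝ, 1 < R ∧ Summable fun k => c k * R ^ k) (hA1 : 0 < APow c 1)
    (α β : ℝ) (hα : 0 ≤ α) (hβ : 0 ≤ β)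
    (n : ℕ) (hn : 1 ≤ n) (t : ℝ) (ht0 : 0 ≤ t) (ht1 : (1 - q ^ n) * t < 1)
    (f : ℝ → ℝ) (hfu : UniformContinuousOn f (Set.Ici 0))
    (hfb : ∃ M : ℝ, ∀ u : ℝ, 0 ≤ u → |f u| ≤ M)
    (x : ℝ) (hx : 0 ≤ x) :
    |Tq c q n t α β f x - f (x + t)| ≤
      2 * modCont f (Real.sqrt (Tq c q n t α β (fun s => (s - (x + t)) ^ 2) x)) := by
  obtain ⟨M, hM⟩ := hfb
  obtain ⟨R, hR, hRs⟩ := hrad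
  have hq' : 0 < 1 - q := by linarith
  set y := qInt q n * t with hy
  have hn0 : 0 < qInt q n := by
    obtain ⟨m, rfl⟩ := Nat.exists_eq_add_of_le' hn
    exact aux_qInt_pos hq0 hq1 m
  have y0 : 0 ≤ y := mul_nonneg hn0.le ht0
  have y1 : (1 - q) * y < 1 := by
    have : (1 - q) * y = (1 - q ^ n) * t := by
      rw [hy]; unfold qInt; field_simp
    rw [this]; exact ht1
  have sb := aux_summable_b hq0 hq1 y0 y1
  have sbn : Summable fun k => ‖y ^ k / qFact q k‖ := sb.norm
  have sc : Summable c := by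
    refine Summable.of_nonneg_of_le hc (fun k => ?_) hRs
    exact le_mul_of_one_le_right (hc k) (one_le_pow₀ hR.le)
  have hA : APow c 1 = ∑' k, c k := by simp [APow]
  have hinv := aux_inv hq0 hq1 y0 y1
  have hb0 : ∀ k, 0 ≤ y ^ k / qFact q k := fun k =>
    div_nonneg (pow_nonneg y0 k) (aux_qFact_pos hq0 hq1 k).le
  have he0 : 0 ≤ qExp q y := tsum_nonneg hb0
  have hE0 : 0 ≤ qExpE q (-y) := by
    by_contra hneg
    push Not at hneg
    nlinarith
  set w : ℕ → ℝ := fun k => qAppell c q y k / qFact q k with hw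
  have hw' : ∀ k, w k = ∑ j ∈ Finset.range (k + 1), c j * (y ^ (k - j) / qFact q (k - j)) := by
    intro k
    have := (aux_qFact_pos hq0 hq1 k).ne'
    simp only [hw, qAppell]
    rw [mul_div_cancel_left₀ _ this]
    exact Finset.sum_congr rfl fun j _ => mul_div_assoc _ _ _
  have w0 : ∀ k, 0 ≤ w k := fun k => by
    rw [hw']
    exact Finset.sum_nonneg fun j _ => mul_nonneg (hc j) (hb0 _)
  have hws : HasSum w (APow c 1 * qExp q y) := by
    have h := hasSum_sum_range_mul_of_summable_norm sc.norm sbn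
    rw [hA, funext hw']
    exact h
  set K := qExpE q (-y) / APow c 1 with hK
  have K0 : 0 ≤ K := div_nonneg hE0 hA1.le
  have hps : HasSum (fun k => K * w k) 1 := by
    have := hws.mul_left K
    have e : K * (APow c 1 * qExp q y) = 1 := by
      rw [hK, div_mul_eq_mul_div, mul_left_comm, hinv, mul_one, div_self hA1.ne']
    rwa [e] at this
  have hT : ∀ g : ℝ → ℝ, Tq c q n t α β g x =
      ∑' k, K * w k * g (x + (qInt q k + α) / (qInt q n + β)) := by
    intro g
    simp only [mul_assoc]
    rw [tsum_mul_left]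
    rfl
  rw [hT, hT]
  refine aux_abs hM (fun k => K * w k) (fun k => x + (qInt q k + α) / (qInt q n + β))
    (fun k => mul_nonneg K0 (w0 k)) hps (fun k => ?_)
    (B := x + (1 / (1 - q) + α) / (qInt q n + β)) (fun k => ?_) (by positivity)
  · have := aux_qInt_nonneg hq0 hq1 k
    positivity
  · have := aux_qInt_le hq0 hq1 k
    have : 0 < qInt q n + β := by linarith
    gcongr
end

section
/- Let α, β ≥ 0, let n ≥ 1 be an integer, and let t ≥ 0 satisfy (1-q^n)·t < 1. Let M > 0 and 0 < γ ≤ 1, and let f : [0,∞) → ℝ be a bounded function satisfying the Hölder (Lipschitz-type) condition |f(u) − f(v)| ≤ M·|u−v|^γ for all u, v ≥ 0. Then for every x ≥ 0, |T_{n,t}^{α,β}(f;q;x) − f(x+t)| ≤ M·(δ_{n,t}(x))^{γ/2}, where δ_{n,t}(x) = T_{n,t}^{α,β}(s ↦ (s − (x+t))²; q; x). -/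
open Filter

theorem qInt_pos_aux {q : ℝ} (hq0 : 0 < q) (hq1 : q < 1) (k : ℕ) : 0 < qInt q (k + 1) := by
  unfold qInt
  have : q ^ (k + 1) < 1 := pow_lt_one₀ hq0.le hq1 (by omega)
  apply div_pos <;> linarith

theorem qInt_nonneg_aux {q : ℝ} (hq0 : 0 < q) (hq1 : q < 1) (k : ℕ) : 0 ≤ qInt q k := by
  unfold qInt
  have : q ^ k ≤ 1 := pow_le_one₀ hq0.le hq1.le
  apply div_nonneg <;> linarith

theorem qInt_le_aux {q : ℝ} (hq0 : 0 < q) (hq1 : q < 1) (k : ℕ) : qInt q k ≤ 1 / (1 - q) := by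
  unfold qInt
  have : 0 < q ^ k := pow_pos hq0 k
  have : 0 < 1 - q := by linarith
  gcongr
  linarith

theorem qFact_pos_aux {q : ℝ} (hq0 : 0 < q) (hq1 : q < 1) (k : ℕ) : 0 < qFact q k :=
  Finset.prod_pos fun i _ => qInt_pos_aux hq0 hq1 i

theorem qFact_succ_aux (q : ℝ) (k : ℕ) : qFact q (k + 1) = qFact q k * qInt q (k + 1) := by
  simp [qFact, Finset.prod_range_succ]

theorem sum_zero_aux {q : ℝ} (hq0 : 0 < q) (hq1 : q < 1) (m : ℕ) :
    ∑ j ∈ Finset.range (m + 1 + 1),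
      (-1 : ℝ) ^ j * q ^ (j * (j - 1) / 2) / (qFact q j * qFact q (m + 1 - j)) = 0 := by
  have h1q : (1 - q) ≠ 0 := by linarith
  have key : qInt q (m + 1) * ∑ j ∈ Finset.range (m + 1 + 1),
      (-1 : ℝ) ^ j * q ^ (j * (j - 1) / 2) / (qFact q j * qFact q (m + 1 - j)) = 0 := by
    have hsplit : ∀ j ∈ Finset.range (m + 1 + 1), qInt q (m + 1) *
        ((-1 : ℝ) ^ j * q ^ (j * (j - 1) / 2) / (qFact q j * qFact q (m + 1 - j))) =
        qInt q j * ((-1 : ℝ) ^ j * q ^ (j * (j - 1) / 2) / (qFact q j * qFact q (m + 1 - j))) +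
        qInt q (m + 1 - j) * ((-1 : ℝ) ^ j * q ^ (j * (j - 1) / 2 + j) /
          (qFact q j * qFact q (m + 1 - j))) := by
      intro j hj
      have hj' : j ≤ m + 1 := by simp at hj; omega
      have : qInt q (m + 1) = qInt q j + q ^ j * qInt q (m + 1 - j) := by
        obtain ⟨l, hl⟩ := Nat.exists_eq_add_of_le hj'
        rw [hl, Nat.add_sub_cancel_left]
        unfold qInt
        field_simp
        ring
      rw [this, pow_add]
      ring
    have h0 : qInt q 0 = 0 := by simp [qInt]
    rw [Finset.mul_sum, Finset.sum_congr rfl hsplit, Finset.sum_add_distrib,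
      Finset.sum_range_succ', Finset.sum_range_succ _ (m + 1)]
    simp only [Nat.sub_self, h0, zero_mul, add_zero]
    rw [← Finset.sum_add_distrib]
    apply Finset.sum_eq_zero
    intro j hj
    have hj' : j ≤ m := by simp at hj; omega
    obtain ⟨l, rfl⟩ := Nat.exists_eq_add_of_le hj'
    have e1 : j + l + 1 - (j + 1) = l := by omega
    have e2 : j + l + 1 - j = l + 1 := by omega
    rw [e1, e2, Nat.triangle_succ, qFact_succ_aux, qFact_succ_aux]
    have a1 := (qFact_pos_aux hq0 hq1 j).ne'
    have a2 := (qFact_pos_aux hq0 hq1 l).ne'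
    have a3 := (qInt_pos_aux hq0 hq1 j).ne'
    have a4 := (qInt_pos_aux hq0 hq1 l).ne'
    field_simp
    ring
  exact (mul_eq_zero.mp key).resolve_left (qInt_pos_aux hq0 hq1 m).ne'

theorem summable_qExp_aux {q : ℝ} (hq0 : 0 < q) (hq1 : q < 1) {y : ℝ} (hy0 : 0 ≤ y)
    (hy1 : (1 - q) * y < 1) : Summable fun k : ℕ => y ^ k / qFact q k := by
  rcases hy0.eq_or_lt with rfl | hy
  · apply summable_of_ne_finset_zero (s := {0})
    intro b hb
    simp at hb
    simp [hb]
  have h1q : 0 < 1 - q := by linarith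
  apply summable_of_ratio_test_tendsto_lt_one (l := (1 - q) * y) hy1
  · filter_upwards with k
    exact (div_pos (pow_pos hy k) (qFact_pos_aux hq0 hq1 k)).ne'
  · have hlim : Tendsto (fun k : ℕ => (1 - q) * y / (1 - q ^ (k + 1))) atTop
        (nhds ((1 - q) * y / (1 - 0))) := by
      apply Tendsto.div tendsto_const_nhds _ (by norm_num)
      exact tendsto_const_nhds.sub
        ((tendsto_add_atTop_iff_nat 1).mpr (tendsto_pow_atTop_nhds_zero_of_lt_one hq0.le hq1))
    rw [sub_zero, div_one] at hlim
    refine hlim.congr fun k => ?_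
    have a1 := qFact_pos_aux hq0 hq1 k
    have a2 := qFact_pos_aux hq0 hq1 (k + 1)
    have a3 := pow_pos hy k
    have a4 := pow_pos hy (k + 1)
    rw [Real.norm_of_nonneg (by positivity), Real.norm_of_nonneg (by positivity),
      qFact_succ_aux]
    have : 0 < 1 - q ^ (k + 1) := by
      have : q ^ (k + 1) < 1 := pow_lt_one₀ hq0.le hq1 (by omega)
      linarith
    unfold qInt
    field_simp
    ring

theorem qExp_mul_aux {q : ℝ} (hq0 : 0 < q) (hq1 : q < 1) {y : ℝ} (hy0 : 0 ≤ y)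
    (hy1 : (1 - q) * y < 1) : qExpE q (-y) * qExp q y = 1 := by
  have hs := summable_qExp_aux hq0 hq1 hy0 hy1
  have hF := qFact_pos_aux hq0 hq1
  have hsE : Summable fun k : ℕ => ‖q ^ (k * (k - 1) / 2) * (-y) ^ k / qFact q k‖ := by
    refine Summable.of_nonneg_of_le (fun _ => norm_nonneg _) (fun k => ?_) hs
    rw [norm_div, norm_mul, norm_pow, norm_pow, norm_neg, Real.norm_of_nonneg hq0.le,
      Real.norm_of_nonneg hy0, Real.norm_of_nonneg (hF k).le]
    have := hF k
    gcongr
    exact mul_le_of_le_one_left (by positivity) (pow_le_one₀ hq0.le hq1.le)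
  unfold qExpE qExp
  rw [tsum_mul_tsum_eq_tsum_sum_range_of_summable_norm hsE hs.norm, tsum_eq_single 0]
  · simp [qFact]
  · intro m hm
    obtain ⟨m, rfl⟩ := Nat.exists_eq_succ_of_ne_zero hm
    have := sum_zero_aux hq0 hq1 m
    rw [← mul_zero (y ^ (m + 1)), ← this, Finset.mul_sum]
    refine Finset.sum_congr rfl fun j hj => ?_
    have hj' : j ≤ m + 1 := by simp at hj; omega
    have hp : y ^ (m + 1) = y ^ j * y ^ (m + 1 - j) := by
      rw [← pow_add, Nat.add_sub_cancel' hj']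
    rw [hp, neg_pow, div_mul_div_comm, Nat.succ_eq_add_one]
    ring

theorem tangent_aux {p d D : ℝ} (hp0 : 0 < p) (hp1 : p ≤ 1) (hd : 0 ≤ d) (hD : 0 < D) :
    d ^ p ≤ D ^ p * (1 + p * (d / D - 1)) := by
  have h1 : 0 ≤ d / D := by positivity
  have := rpow_one_add_le_one_add_mul_self (s := d / D - 1) (by linarith) hp0.le hp1
  have h2 : d ^ p = D ^ p * (1 + (d / D - 1)) ^ p := by
    rw [add_sub_cancel, ← Real.mul_rpow hD.le h1]
    congr 1
    field_simp
  rw [h2]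
  gcongr

theorem jensen_aux {p : ℝ} (hp0 : 0 < p) (hp1 : p ≤ 1) (w d : ℕ → ℝ) (hw : ∀ k, 0 ≤ w k)
    (hd : ∀ k, 0 ≤ d k) (hw1 : HasSum w 1) (hwd : Summable fun k => w k * d k)
    (hwp : Summable fun k => w k * d k ^ p) :
    ∑' k, w k * d k ^ p ≤ (∑' k, w k * d k) ^ p := by
  set D := ∑' k, w k * d k with hDdef
  have hD0 : 0 ≤ D := tsum_nonneg fun k => mul_nonneg (hw k) (hd k)
  rcases hD0.eq_or_lt with h | hD
  · have hz : ∀ k, w k * d k = 0 := by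
      have h2 : HasSum (fun k => w k * d k) 0 := by rw [h]; exact hwd.hasSum
      have := (hasSum_zero_iff_of_nonneg (fun k => mul_nonneg (hw k) (hd k))).mp h2
      exact fun k => congrFun this k
    have : ∀ k, w k * d k ^ p = 0 := by
      intro k
      rcases mul_eq_zero.mp (hz k) with h | h
      · simp [h]
      · simp [h, Real.zero_rpow hp0.ne']
    simp only [this, tsum_zero]
    positivity
  · have h1 : HasSum (fun k => D ^ p * (1 - p) * w k + D ^ p * p / D * (w k * d k))
        (D ^ p * (1 - p) * 1 + D ^ p * p / D * D) :=
      (hw1.mul_left _).add (hwd.hasSum.mul_left _)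
    have h2 : D ^ p * (1 - p) * 1 + D ^ p * p / D * D = D ^ p := by
      field_simp
      ring
    rw [h2] at h1
    refine hasSum_le (fun k => ?_) hwp.hasSum h1
    have := mul_le_mul_of_nonneg_left (tangent_aux hp0 hp1 (hd k) hD) (hw k)
    refine this.trans (le_of_eq ?_)
    field_simp
    ring

theorem summable_bdd_aux (w g : ℕ → ℝ) (hw : ∀ k, 0 ≤ w k) (hs : Summable w)
    (K : ℝ) (hg : ∀ k, |g k| ≤ K) : Summable fun k => w k * g k := by
  refine Summable.of_norm_bounded (hs.mul_right K) fun k => ?_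
  rw [norm_mul, Real.norm_of_nonneg (hw k)]
  exact mul_le_mul_of_nonneg_left (hg k) (hw k)

/-- for `f` bounded with `|f(u) − f(v)| ≤ M|u−v|^γ` (`0 < γ ≤ 1`),
    `|T_{n,t}^{α,β}(f;q;x) − f(x+t)| ≤ M (δ_{n,t}(x))^{γ/2}`. -/
theorem stmt_12 (q : ℝ) (hq0 : 0 < q) (hq1 : q < 1)
    (c : ℕ → ℝ) (hc : ∀ k, 0 ≤ c k)
    (hrad : ∃ R : ℝ, 1 < R ∧ Summable fun k => c k * R ^ k) (hA1 : 0 < APow c 1)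
    (α β : ℝ) (hα : 0 ≤ α) (hβ : 0 ≤ β)
    (n : ℕ) (hn : 1 ≤ n) (t : ℝ) (ht0 : 0 ≤ t) (ht1 : (1 - q ^ n) * t < 1)
    (M γ : ℝ) (hM : 0 < M) (hγ0 : 0 < γ) (hγ1 : γ ≤ 1)
    (f : ℝ → ℝ) (hfb : ∃ K : ℝ, ∀ u : ℝ, 0 ≤ u → |f u| ≤ K)
    (hf : ∀ u v : ℝ, 0 ≤ u → 0 ≤ v → |f u - f v| ≤ M * |u - v| ^ γ)
    (x : ℝ) (hx : 0 ≤ x) :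
    |Tq c q n t α β f x - f (x + t)| ≤
      M * (Tq c q n t α β (fun s => (s - (x + t)) ^ 2) x) ^ (γ / 2) := by
  obtain ⟨K, hK⟩ := hfb
  have h1q : 0 < 1 - q := by linarith
  have hIn := qInt_pos_aux hq0 hq1 (n - 1)
  rw [Nat.sub_add_cancel hn] at hIn
  set y := qInt q n * t with hy
  have hy0 : 0 ≤ y := by positivity
  have hy1 : (1 - q) * y < 1 := by
    have : (1 - q) * y = (1 - q ^ n) * t := by
      rw [hy, qInt]
      field_simp
    linarith
  have hF := qFact_pos_aux hq0 hq1
  have hs := summable_qExp_aux hq0 hq1 hy0 hy1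
  have hmul := qExp_mul_aux hq0 hq1 hy0 hy1
  have hcs : Summable c := by
    obtain ⟨R, hR, hRs⟩ := hrad
    refine Summable.of_nonneg_of_le hc (fun k => ?_) hRs
    exact le_mul_of_one_le_right (hc k) (one_le_pow₀ hR.le)
  have hA : APow c 1 = ∑' k, c k := by simp [APow]
  have he0 : 0 ≤ qExp q y := tsum_nonneg fun k => div_nonneg (pow_nonneg hy0 k) (hF k).le
  have hE0 : 0 ≤ qExpE q (-y) := by
    by_contra hneg
    nlinarith
  have hPe : ∀ k, qAppell c q y k / qFact q k =
      ∑ j ∈ Finset.range (k + 1), c j * (y ^ (k - j) / qFact q (k - j)) := by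
    intro k
    rw [qAppell, mul_div_cancel_left₀ _ (hF k).ne']
    exact Finset.sum_congr rfl fun j _ => mul_div_assoc _ _ _
  have hPsum : Summable fun k => qAppell c q y k / qFact q k := by
    simp only [hPe]
    exact (summable_norm_sum_mul_range_of_summable_norm hcs.norm hs.norm).of_norm
  have hPt : ∑' k, qAppell c q y k / qFact q k = APow c 1 * qExp q y := by
    simp only [hPe]
    rw [hA, qExp, tsum_mul_tsum_eq_tsum_sum_range_of_summable_norm hcs.norm hs.norm]
  have hP0 : ∀ k, 0 ≤ qAppell c q y k / qFact q k := by
    intro k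
    rw [hPe]
    exact Finset.sum_nonneg fun j _ =>
      mul_nonneg (hc j) (div_nonneg (pow_nonneg hy0 _) (hF _).le)
  obtain ⟨w, hwdef⟩ : ∃ w : ℕ → ℝ, ∀ k, w k =
    qExpE q (-y) / APow c 1 * (qAppell c q y k / qFact q k) := ⟨_, fun _ => rfl⟩
  have hw0 : ∀ k, 0 ≤ w k := fun k => by
    rw [hwdef]
    exact mul_nonneg (div_nonneg hE0 hA1.le) (hP0 k)
  have hw1 : HasSum w 1 := by
    have := hPsum.hasSum.mul_left (qExpE q (-y) / APow c 1)
    rw [hPt] at this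
    have e : qExpE q (-y) / APow c 1 * (APow c 1 * qExp q y) = 1 := by
      refine Eq.trans ?_ hmul
      field_simp
    rw [e] at this
    simpa only [← hwdef] using this
  obtain ⟨s, hsdef⟩ : ∃ s : ℕ → ℝ, ∀ k, s k = x + (qInt q k + α) / (qInt q n + β) :=
    ⟨_, fun _ => rfl⟩
  have hT : ∀ g : ℝ → ℝ, Tq c q n t α β g x = ∑' k, w k * g (s k) := by
    intro g
    rw [Tq, ← tsum_mul_left]
    refine tsum_congr fun k => ?_
    rw [hwdef, hsdef, mul_assoc]
  have hI0 := qInt_nonneg_aux hq0 hq1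
  have hs0 : ∀ k, 0 ≤ s k := fun k => by
    have := hI0 k
    rw [hsdef]
    positivity
  obtain ⟨B, hB⟩ : ∃ B : ℝ, ∀ k, s k ≤ B := by
    refine ⟨x + (1 / (1 - q) + α) / (qInt q n + β), fun k => ?_⟩
    have := qInt_le_aux hq0 hq1 k
    rw [hsdef]
    gcongr
  have hd0 : ∀ k, 0 ≤ (s k - (x + t)) ^ 2 := fun k => sq_nonneg _
  have hdB : ∀ k, (s k - (x + t)) ^ 2 ≤ (B + (x + t)) ^ 2 := fun k => by
    have := hs0 k
    have := hB k
    apply sq_le_sq'  <;> linarith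
  have hwd : Summable fun k => w k * (s k - (x + t)) ^ 2 :=
    summable_bdd_aux w _ hw0 hw1.summable ((B + (x + t)) ^ 2) fun k => by
      rw [abs_of_nonneg (hd0 k)]
      exact hdB k
  have hwp : Summable fun k => w k * ((s k - (x + t)) ^ 2) ^ (γ / 2) :=
    summable_bdd_aux w _ hw0 hw1.summable (((B + (x + t)) ^ 2) ^ (γ / 2)) fun k => by
      rw [abs_of_nonneg (Real.rpow_nonneg (hd0 k) _)]
      exact Real.rpow_le_rpow (hd0 k) (hdB k) (by linarith)
  have hwf : Summable fun k => w k * f (s k) :=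
    summable_bdd_aux w _ hw0 hw1.summable K fun k => hK _ (hs0 k)
  have hJ := jensen_aux (by linarith : 0 < γ / 2) (by linarith) w _ hw0 hd0 hw1 hwd hwp
  rw [hT, hT]
  have hsub : HasSum (fun k => w k * f (s k) - w k * f (x + t))
      (∑' k, w k * f (s k) - f (x + t)) := by
    have := hwf.hasSum.sub (hw1.mul_right (f (x + t)))
    rwa [one_mul] at this
  rw [← hsub.tsum_eq, ← Real.norm_eq_abs]
  refine (tsum_of_norm_bounded (hwp.hasSum.mul_left M) fun k => ?_).trans
    (mul_le_mul_of_nonneg_left hJ hM.le)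
  have h1 := hf (s k) (x + t) (hs0 k) (by linarith)
  have h2 : ((s k - (x + t)) ^ 2) ^ (γ / 2) = |s k - (x + t)| ^ γ := by
    rw [← sq_abs, ← Real.rpow_natCast, ← Real.rpow_mul (abs_nonneg _)]
    congr 1
    push_cast
    ring
  rw [← mul_sub, norm_mul, Real.norm_of_nonneg (hw0 k), Real.norm_eq_abs, h2]
  calc w k * |f (s k) - f (x + t)| ≤ w k * (M * |s k - (x + t)| ^ γ) :=
        mul_le_mul_of_nonneg_left h1 (hw0 k)
    _ = _ := by ring
end
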